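/- arXiv:hep-th/0604130 — 13 statements merged into one kernel-verified Lean document; each statement's English description precedes it below -/
import Mathlib

section
/- Let a,b,c,d ∈ ℝ with ad − bc = 1, a ≠ 0 and |b| < |a|, and set μ = √(1 − b²/a²). Then the matrix identity [[a, b],[c, d]] = [[aμ, 0],[(ac−bd)/(aμ), 1/(aμ)]] · [[1/μ, b/(aμ)],[b/(aμ), 1/μ]] holds, and both factors have determinant 1; thus every element of SL(2,ℝ) with |b| < |a| factorizes as a lower triangular matrix with determinant 1 times a symmetric 'boost' matrix with determinant 1. -/
/-- Every element of `SL(2,ℝ)` with `|b| < |a|` factorizes as a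
lower triangular matrix of determinant 1 times a symmetric "boost" matrix of
determinant 1:
`[[a,b],[c,d]] = [[aμ,0],[(ac−bd)/(aμ), 1/(aμ)]] · [[1/μ, b/(aμ)],[b/(aμ), 1/μ]]`
where `μ = √(1 − b²/a²)`. -/
theorem sl2_factorisation (a b c d : ℝ) (hdet : a * d - b * c = 1)
    (ha : a ≠ 0) (hb : |b| < |a|) (μ : ℝ) (hμ : μ = Real.sqrt (1 - b ^ 2 / a ^ 2)) :
    !![a, b; c, d] =
      !![a * μ, 0; (a * c - b * d) / (a * μ), 1 / (a * μ)] *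
        !![1 / μ, b / (a * μ); b / (a * μ), 1 / μ] ∧
    Matrix.det !![a * μ, 0; (a * c - b * d) / (a * μ), 1 / (a * μ)] = 1 ∧
    Matrix.det !![1 / μ, b / (a * μ); b / (a * μ), 1 / μ] = 1 ∧
    Matrix.det !![a, b; c, d] = 1 := by
  have hpos : 0 < 1 - b ^ 2 / a ^ 2 := by
    rw [sub_pos, div_lt_one (by positivity)]
    exact sq_lt_sq.mpr hb
  have hμ0 : μ ≠ 0 := hμ ▸ (Real.sqrt_pos.mpr hpos).ne'
  have hsq : a ^ 2 * μ ^ 2 = a ^ 2 - b ^ 2 := by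
    rw [hμ, Real.sq_sqrt hpos.le]
    field_simp
  have h₀₀ : a = a * μ * (1 / μ) + 0 * (b / (a * μ)) := by
    rw [zero_mul, add_zero]
    field_simp
  have h₀₁ : b = a * μ * (b / (a * μ)) + 0 * (1 / μ) := by
    rw [zero_mul, add_zero]
    field_simp
  have h₁₀ : c = (a * c - b * d) / (a * μ) * (1 / μ) + 1 / (a * μ) * (b / (a * μ)) := by
    field_simp
    linear_combination c * hsq + b * hdet
  have h₁₁ : d = (a * c - b * d) / (a * μ) * (b / (a * μ)) + 1 / (a * μ) * (1 / μ) := by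
    field_simp
    linear_combination d * hsq + a * hdet
  refine ⟨?_, ?_, ?_, ?_⟩
  · rw [Matrix.mul_fin_two, ← h₁₀, ← h₁₁, ← h₀₀, ← h₀₁]
  · rw [Matrix.det_fin_two_of]
    field_simp
    simp
  · rw [Matrix.det_fin_two_of]
    field_simp
    linear_combination -hsq
  · rw [Matrix.det_fin_two_of, hdet]
end

section
/- For λ > 0, the map (p⁰, p¹, θ) ↦ M(p⁰,p¹)·B(θ) is a bijection from ℝ³ onto the subset { X ∈ SL(2,ℝ) : X₁₁ > |X₁₂| } of SL(2,ℝ), where M(p⁰,p¹) = [[e^{λp⁰/2}, 0],[λp¹ e^{λp⁰/2}, e^{−λp⁰/2}]] and B(θ) = [[cosh(θ/2), sinh(θ/2)],[sinh(θ/2), cosh(θ/2)]]. -/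
/-- For `λ > 0` the map `(p⁰,p¹,θ) ↦ M(p⁰,p¹)·B(θ)` is a bijection
from `ℝ³` onto `{X ∈ SL(2,ℝ) : X₁₁ > |X₁₂|}`, where
`M(p⁰,p¹) = [[e^{λp⁰/2},0],[λp¹e^{λp⁰/2}, e^{−λp⁰/2}]]` and
`B(θ) = [[cosh(θ/2), sinh(θ/2)],[sinh(θ/2), cosh(θ/2)]]`. -/
theorem bicrossproduct_local_factorisation (lam : ℝ) (hlam : 0 < lam) :
    Set.BijOn
      (fun p : ℝ × ℝ × ℝ =>
        (!![Real.exp (lam * p.1 / 2), 0;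
            lam * p.2.1 * Real.exp (lam * p.1 / 2), Real.exp (-(lam * p.1) / 2)] *
         !![Real.cosh (p.2.2 / 2), Real.sinh (p.2.2 / 2);
            Real.sinh (p.2.2 / 2), Real.cosh (p.2.2 / 2)] : Matrix (Fin 2) (Fin 2) ℝ))
      Set.univ
      {X : Matrix (Fin 2) (Fin 2) ℝ | X.det = 1 ∧ |X 0 1| < X 0 0} := by
  have hneg : ∀ x : ℝ, Real.exp (-(lam * x) / 2) = (Real.exp (lam * x / 2))⁻¹ := fun x => by
    rw [← Real.exp_neg, neg_div]
  refine ⟨?_, ?_, ?_⟩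
  · rintro ⟨x, y, t⟩ -
    have hE := Real.exp_pos (lam * x / 2)
    have hcs := Real.cosh_sq_sub_sinh_sq (t / 2)
    have hs : |Real.sinh (t / 2)| < Real.cosh (t / 2) :=
      abs_lt_of_sq_lt_sq (by linarith) (Real.cosh_pos _).le
    refine ⟨?_, ?_⟩
    · simp only [Matrix.det_mul, Matrix.det_fin_two_of, hneg]
      field_simp
      linarith
    · simpa [Matrix.mul_apply, Fin.sum_univ_two, abs_mul] using mul_lt_mul_of_pos_left hs hE
  · rintro ⟨x, y, t⟩ - ⟨x', y', t'⟩ - h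
    have h00 := congrFun (congrFun h 0) 0
    have h01 := congrFun (congrFun h 0) 1
    have h10 := congrFun (congrFun h 1) 0
    simp only [Matrix.mul_apply, Fin.sum_univ_two, Matrix.of_apply, Matrix.cons_val_zero,
      Matrix.cons_val_one, Matrix.cons_val', Matrix.cons_val_fin_one, zero_mul,
      add_zero] at h00 h01 h10
    have hE : Real.exp (lam * x / 2) = Real.exp (lam * x' / 2) := by
      rw [← sq_eq_sq₀ (Real.exp_pos _).le (Real.exp_pos _).le]
      calc Real.exp (lam * x / 2) ^ 2
          = (Real.exp (lam * x / 2) * Real.cosh (t / 2)) ^ 2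
            - (Real.exp (lam * x / 2) * Real.sinh (t / 2)) ^ 2 := by
            rw [mul_pow, mul_pow, ← mul_sub, Real.cosh_sq_sub_sinh_sq, mul_one]
        _ = Real.exp (lam * x' / 2) ^ 2 := by
            rw [h00, h01, mul_pow, mul_pow, ← mul_sub, Real.cosh_sq_sub_sinh_sq, mul_one]
    obtain rfl : x = x' := by
      have hx := Real.exp_injective hE
      exact mul_left_cancel₀ hlam.ne' (by linarith)
    obtain rfl : t = t' := by
      have ht := Real.sinh_injective (mul_left_cancel₀ (Real.exp_ne_zero _) h01)
      linarith
    obtain rfl : y = y' := mul_left_cancel₀ hlam.ne' <|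
      mul_right_cancel₀ (Real.exp_ne_zero _) <|
        mul_right_cancel₀ (Real.cosh_pos (t / 2)).ne' (add_right_cancel h10)
    rfl
  · rintro X ⟨hdet, hX⟩
    rw [Matrix.det_fin_two] at hdet
    have ha : 0 < X 0 0 := (abs_nonneg _).trans_lt hX
    have hab : 0 < X 0 0 ^ 2 - X 0 1 ^ 2 := sub_pos.2 (sq_lt_sq.2 (hX.trans_le (le_abs_self _)))
    obtain ⟨E, hE, hE2⟩ : ∃ E : ℝ, 0 < E ∧ E ^ 2 = X 0 0 ^ 2 - X 0 1 ^ 2 :=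
      ⟨_, Real.sqrt_pos.2 hab, Real.sq_sqrt hab.le⟩
    have hsinh : Real.sinh (2 * Real.arsinh (X 0 1 / E) / 2) = X 0 1 / E := by
      rw [mul_div_cancel_left₀ _ two_ne_zero, Real.sinh_arsinh]
    have hcosh : Real.cosh (2 * Real.arsinh (X 0 1 / E) / 2) = X 0 0 / E := by
      rw [← sq_eq_sq₀ (Real.cosh_pos _).le (div_pos ha hE).le, Real.cosh_sq, hsinh]
      field_simp
      linarith
    have hexp : Real.exp (lam * (2 * Real.log E / lam) / 2) = E := by
      rw [mul_div_cancel₀ _ hlam.ne', mul_div_cancel_left₀ _ two_ne_zero, Real.exp_log hE]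
    refine ⟨(2 * Real.log E / lam,
      (X 1 0 * X 0 0 - X 1 1 * X 0 1) / (lam * E ^ 2), 2 * Real.arsinh (X 0 1 / E)),
      Set.mem_univ _, ?_⟩
    simp only [hneg, hexp, hsinh, hcosh]
    ext i j
    fin_cases i <;> fin_cases j <;> simp [Matrix.mul_apply, Fin.sum_univ_two] <;> field_simp
    · rw [hE2]
      linear_combination (-X 0 1) * hdet
    · rw [hE2]
      linear_combination (-X 0 0) * hdet
end

section
/- Let λ > 0, θ, p⁰, p¹ ∈ ℝ, and write C = cosh(θ/2), S = sinh(θ/2), q = e^{−λp⁰}. Assume C + Sλp¹ > 0 and (C + S(λp¹ − q))(C + S(λp¹ + q)) > 0, and set D = (C + Sλp¹)² − S²q², p⁰' = p⁰ + λ⁻¹ log D, p¹' = ((C + Sλp¹)(S + Cλp¹) − SCq²)/(λD), and θ' = 2·arsinh(Sq/√D). Then the refactorization identity B(θ)·M(p⁰,p¹) = M(p⁰',p¹')·B(θ') holds in SL(2,ℝ). -/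
/-- The refactorization identity `B(θ)·M(p⁰,p¹) = M(p⁰',p¹')·B(θ')`
in `SL(2,ℝ)`, where with `C = cosh(θ/2)`, `S = sinh(θ/2)`, `q = e^{−λp⁰}`,
`D = (C+Sλp¹)² − S²q²`, assuming `C + Sλp¹ > 0` and
`(C + S(λp¹−q))(C + S(λp¹+q)) > 0`, the boosted data are
`p⁰' = p⁰ + λ⁻¹ log D`, `p¹' = ((C+Sλp¹)(S+Cλp¹) − SCq²)/(λD)` and
`θ' = 2 arsinh(Sq/√D)`. -/
theorem boost_refactorisation (lam θ p0 p1 : ℝ) (hlam : 0 < lam)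
    (C S q D p0' p1' θ' : ℝ)
    (hC : C = Real.cosh (θ / 2)) (hS : S = Real.sinh (θ / 2))
    (hq : q = Real.exp (-(lam * p0)))
    (hpos : 0 < C + S * (lam * p1))
    (hprod : 0 < (C + S * (lam * p1 - q)) * (C + S * (lam * p1 + q)))
    (hD : D = (C + S * (lam * p1)) ^ 2 - S ^ 2 * q ^ 2)
    (hp0' : p0' = p0 + lam⁻¹ * Real.log D)
    (hp1' : p1' = ((C + S * (lam * p1)) * (S + C * (lam * p1)) - S * C * q ^ 2) / (lam * D))
    (hθ' : θ' = 2 * Real.arsinh (S * q / Real.sqrt D)) :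
    !![Real.cosh (θ / 2), Real.sinh (θ / 2); Real.sinh (θ / 2), Real.cosh (θ / 2)] *
      !![Real.exp (lam * p0 / 2), 0;
         lam * p1 * Real.exp (lam * p0 / 2), Real.exp (-(lam * p0) / 2)] =
    !![Real.exp (lam * p0' / 2), 0;
       lam * p1' * Real.exp (lam * p0' / 2), Real.exp (-(lam * p0') / 2)] *
      !![Real.cosh (θ' / 2), Real.sinh (θ' / 2); Real.sinh (θ' / 2), Real.cosh (θ' / 2)] := by
  set A := C + S * (lam * p1) with hA
  set x := lam * p1 with hx
  have hCS : C ^ 2 - S ^ 2 = 1 := by rw [hC, hS]; exact Real.cosh_sq_sub_sinh_sq _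
  have hDpos : 0 < D := by
    rw [hD]; convert hprod using 1; rw [hA]; ring
  have hr : 0 < Real.sqrt D := Real.sqrt_pos.mpr hDpos
  have hrD : Real.sqrt D ^ 2 = D := Real.sq_sqrt hDpos.le
  have hlog : lam * p0' = lam * p0 + Real.log D := by
    rw [hp0']; field_simp
  have hsqrt : Real.exp (Real.log D / 2) = Real.sqrt D := by
    rw [← Real.log_sqrt hDpos.le, Real.exp_log hr]
  have hE' : Real.exp (lam * p0' / 2) = Real.exp (lam * p0 / 2) * Real.sqrt D := by
    rw [hlog, add_div, Real.exp_add, hsqrt]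
  have hF' : Real.exp (-(lam * p0') / 2) = Real.exp (-(lam * p0) / 2) / Real.sqrt D := by
    rw [hlog, ← hsqrt, ← Real.exp_sub]; congr 1; ring
  have hF : Real.exp (-(lam * p0) / 2) = Real.exp (lam * p0 / 2) * q := by
    rw [hq, ← Real.exp_add]; congr 1; ring
  have hsinh : Real.sinh (θ' / 2) = S * q / Real.sqrt D := by
    rw [hθ', mul_div_cancel_left₀ _ two_ne_zero, Real.sinh_arsinh]
  have hcosh : Real.cosh (θ' / 2) = A / Real.sqrt D := by
    rw [← sq_eq_sq₀ (Real.cosh_pos _).le (by positivity), Real.cosh_sq, hsinh, div_pow, div_pow,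
      hrD]
    field_simp
    linear_combination hD
  have hx' : lam * p1' * D = A * (S + C * x) - S * C * q ^ 2 := by
    rw [hp1']; field_simp
  rw [hE', hF', hF, hsinh, hcosh, ← hC, ← hS]
  generalize Real.exp (lam * p0 / 2) = E
  generalize Real.sqrt D = r at hr hrD
  generalize lam * p1' = y at hx'
  have h10 : (S + C * x) * r ^ 2 = y * r ^ 2 * A + S * q ^ 2 := by
    rw [hrD]
    linear_combination (S + C * x) * hD - A * hx' + q ^ 2 * S * hCS + S * q ^ 2 * C * hA
  have h11 : C * r ^ 2 = y * r ^ 2 * S + A := by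
    rw [hrD]
    linear_combination C * hD - S * hx' + A * C * hA + A * hCS
  ext i j
  fin_cases i <;> fin_cases j <;> simp [Matrix.mul_apply, Fin.sum_univ_two]
  · field_simp
    linear_combination -E * hA
  · field_simp
  · field_simp
    linear_combination E * h10
  · field_simp
    linear_combination E * q * h11
end

section
/- Let λ > 0, θ, p⁰, p¹ ∈ ℝ, and write C = cosh(θ/2), S = sinh(θ/2), q = e^{−λp⁰}. The product X = B(θ)·M(p⁰,p¹) satisfies X₁₁ > |X₁₂| (i.e., lies in the domain where the factorization X = M(p⁰',p¹')·B(θ') exists) if and only if C + Sλp¹ > 0 and (C + S(λp¹ − q))(C + S(λp¹ + q)) > 0. -/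
/-- With `C = cosh(θ/2)`, `S = sinh(θ/2)`, `q = e^{−λp⁰}`, the
product `X = B(θ)·M(p⁰,p¹)` satisfies `X₁₁ > |X₁₂|` (i.e. lies in the domain
where the factorization `X = M(p⁰',p¹')·B(θ')` exists) if and only if
`C + Sλp¹ > 0` and `(C + S(λp¹−q))(C + S(λp¹+q)) > 0`. -/
theorem refactorisation_domain (lam θ p0 p1 : ℝ) (hlam : 0 < lam)
    (C S q : ℝ)
    (hC : C = Real.cosh (θ / 2)) (hS : S = Real.sinh (θ / 2))
    (hq : q = Real.exp (-(lam * p0)))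
    (X : Matrix (Fin 2) (Fin 2) ℝ)
    (hX : X =
      !![Real.cosh (θ / 2), Real.sinh (θ / 2); Real.sinh (θ / 2), Real.cosh (θ / 2)] *
        !![Real.exp (lam * p0 / 2), 0;
           lam * p1 * Real.exp (lam * p0 / 2), Real.exp (-(lam * p0) / 2)]) :
    |X 0 1| < X 0 0 ↔
      (0 < C + S * (lam * p1) ∧
       0 < (C + S * (lam * p1 - q)) * (C + S * (lam * p1 + q))) := by
  have h00 : X 0 0 = Real.exp (lam * p0 / 2) * (C + S * (lam * p1)) := by
    simp [hX, hC, hS]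
    ring
  have h01 : X 0 1 = Real.exp (lam * p0 / 2) * (S * q) := by
    have hexp : Real.exp (-(lam * p0) / 2) = Real.exp (lam * p0 / 2) * q := by
      rw [hq, ← Real.exp_add]
      ring_nf
    simp [hX, hS, hexp]
    ring
  have hprod : (C + S * (lam * p1 - q)) * (C + S * (lam * p1 + q)) =
      (C + S * (lam * p1)) ^ 2 - (S * q) ^ 2 := by
    ring
  rw [h00, h01, abs_mul, abs_of_pos (Real.exp_pos _),
    mul_lt_mul_iff_right₀ (Real.exp_pos _), hprod, sub_pos]
  constructor
  · intro h
    have hpos := (abs_nonneg (S * q)).trans_lt h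
    exact ⟨hpos, sq_lt_sq.2 (by rwa [abs_of_pos hpos])⟩
  · rintro ⟨hpos, h⟩
    exact abs_lt_of_sq_lt_sq h hpos.le
end

section
/- Let λ > 0 and p⁰, p¹ ∈ ℝ, and write q = e^{−λp⁰}. Then the refactorization condition (cosh(θ/2) + sinh(θ/2)(λp¹ − q))·(cosh(θ/2) + sinh(θ/2)(λp¹ + q)) > 0 holds for all θ ∈ ℝ if and only if (p⁰,p¹) lies in the closed upper mass shell region A, i.e., if and only if λ|p¹| ≤ 1 − e^{−λp⁰}. -/
theorem Real.cosh_add_sinh_mul_pos {a : ℝ} (ha : |a| ≤ 1) (t : ℝ) :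
    0 < Real.cosh t + Real.sinh t * a := by
  have h := abs_le.mp ha
  rw [Real.cosh_eq, Real.sinh_eq]
  have h₁ := Real.exp_pos t
  have h₂ := Real.exp_pos (-t)
  rcases le_total a 0 with h₀ | h₀
  · nlinarith [mul_nonneg h₁.le (by linarith : 0 ≤ 1 + a), mul_nonneg h₂.le (neg_nonneg.mpr h₀)]
  · nlinarith [mul_nonneg h₁.le h₀, mul_nonneg h₂.le (by linarith : 0 ≤ 1 - a)]

theorem Real.exists_cosh_add_sinh_mul_eq_zero {a : ℝ} (ha : 1 < |a|) :
    ∃ t : ℝ, Real.cosh t + Real.sinh t * a = 0 := by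
  have ha₀ : a ≠ 0 := by
    rintro rfl
    norm_num at ha
  have hmem : -a⁻¹ ∈ Set.Ioo (-1 : ℝ) 1 := by
    rw [Set.mem_Ioo, ← abs_lt, abs_neg, abs_inv]
    exact inv_lt_one_of_one_lt₀ ha
  refine ⟨Real.artanh (-a⁻¹), ?_⟩
  have h := Real.tanh_artanh hmem
  rw [Real.tanh_eq_sinh_div_cosh, div_eq_iff (Real.cosh_pos _).ne'] at h
  rw [h]
  field_simp
  ring


/-- For `λ > 0` and `q = e^{−λp⁰}`, the refactorization condition
`(cosh(θ/2) + sinh(θ/2)(λp¹−q))(cosh(θ/2) + sinh(θ/2)(λp¹+q)) > 0` holds for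
all rapidities `θ` if and only if `(p⁰,p¹)` lies in the closed upper mass
shell region A, i.e. iff `λ|p¹| ≤ 1 − e^{−λp⁰}`. -/
theorem boost_defined_for_all_theta_iff_region_A (lam p0 p1 q : ℝ)
    (hlam : 0 < lam) (hq : q = Real.exp (-(lam * p0))) :
    (∀ θ : ℝ,
      0 < (Real.cosh (θ / 2) + Real.sinh (θ / 2) * (lam * p1 - q)) *
          (Real.cosh (θ / 2) + Real.sinh (θ / 2) * (lam * p1 + q))) ↔
    lam * |p1| ≤ 1 - Real.exp (-(lam * p0)) := by
  have hq₀ : 0 < q := hq ▸ Real.exp_pos _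
  rw [← hq, ← abs_of_pos hlam, ← abs_mul, abs_of_pos hlam]
  constructor
  · intro h
    have h₁ : |lam * p1 - q| ≤ 1 := by
      by_contra! hlt
      obtain ⟨t, ht⟩ := Real.exists_cosh_add_sinh_mul_eq_zero hlt
      simpa [ht] using h (2 * t)
    have h₂ : |lam * p1 + q| ≤ 1 := by
      by_contra! hlt
      obtain ⟨t, ht⟩ := Real.exists_cosh_add_sinh_mul_eq_zero hlt
      simpa [ht] using h (2 * t)
    rw [abs_le] at h₁ h₂ ⊢
    constructor <;> linarith
  · intro h θ
    rw [abs_le] at h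
    exact mul_pos
      (Real.cosh_add_sinh_mul_pos (abs_le.mpr ⟨by linarith, by linarith⟩) _)
      (Real.cosh_add_sinh_mul_pos (abs_le.mpr ⟨by linarith, by linarith⟩) _)
end

section
/- Let λ > 0 and p⁰, p¹ ∈ ℝ with q = e^{−λp⁰}, and suppose (p⁰,p¹) lies strictly outside region A, i.e., λ|p¹| > 1 − e^{−λp⁰}. If q − λp¹ > 1 then there is a unique θ_c > 0 with coth(θ_c/2) = q − λp¹; if q + λp¹ > 1 then there is a unique θ_c < 0 with −coth(θ_c/2) = q + λp¹. In either case, writing D(θ) = (cosh(θ/2) + sinh(θ/2)λp¹)² − sinh²(θ/2)q², one has D(θ) > 0 for all θ strictly between 0 and θ_c, D(θ_c) = 0, and the boosted energy p⁰'(θ) = p⁰ + λ⁻¹ log D(θ) tends to −∞ as θ tends to θ_c from the side of 0. Thus any off-shell momentum is sent to infinitely negative energy by a finite boost. -/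
/-- The hyperbolic cotangent. -/
noncomputable def Real.coth (x : ℝ) : ℝ := Real.cosh x / Real.sinh x

theorem Real.exists_pos_coth_eq {a : ℝ} (ha : 1 < a) : ∃ x, 0 < x ∧ Real.coth x = a := by
  have ha' : 0 < a - 1 := by linarith
  have hr : 1 < (a + 1) / (a - 1) := by rw [lt_div_iff₀ ha']; linarith
  have hy : 1 < √((a + 1) / (a - 1)) := Real.lt_sqrt_of_sq_lt (by simpa using hr)
  have hsq : √((a + 1) / (a - 1)) ^ 2 = (a + 1) / (a - 1) := Real.sq_sqrt (by linarith)
  generalize √((a + 1) / (a - 1)) = y at hy hsq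
  have hy0 : 0 < y := by linarith
  refine ⟨Real.log y, Real.log_pos hy, ?_⟩
  have hne : y - y⁻¹ ≠ 0 := by
    have := inv_lt_one_of_one_lt₀ hy
    linarith
  rw [Real.coth, Real.cosh_log hy0, Real.sinh_log hy0, div_eq_iff (by simpa using hne)]
  rw [eq_div_iff ha'.ne'] at hsq
  field_simp
  linarith

theorem Real.sinh_sub_eq_of_coth_eq {a x y : ℝ} (hx : 0 < x) (h : Real.coth x = a) :
    Real.sinh (x - y) = Real.sinh x * (Real.cosh y - Real.sinh y * a) := by
  have hs : Real.sinh x ≠ 0 := (Real.sinh_pos_iff.2 hx).ne'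
  rw [Real.coth, div_eq_iff hs] at h
  rw [Real.sinh_sub, h]
  ring

theorem Real.existsUnique_pos_coth_half_eq {a : ℝ} (ha : 1 < a) :
    ∃! θ : ℝ, 0 < θ ∧ Real.coth (θ / 2) = a := by
  obtain ⟨x, hx, hxa⟩ := Real.exists_pos_coth_eq ha
  refine ⟨2 * x, ⟨by linarith, by simpa using hxa⟩, ?_⟩
  rintro θ ⟨hθ, hθa⟩
  have hs : 0 < Real.sinh (θ / 2) := Real.sinh_pos_iff.2 (by linarith)
  have h := Real.sinh_sub_eq_of_coth_eq (y := θ / 2) hx hxa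
  rw [← hθa, Real.coth, mul_div_cancel₀ _ hs.ne', sub_self, mul_zero, Real.sinh_eq_zero] at h
  linarith

theorem Real.coth_neg (x : ℝ) : Real.coth (-x) = -Real.coth x := by
  simp [Real.coth, div_neg]

/-- A product of two hyperbolic factors is positive before the zero of the first factor, vanishes
there, and its logarithm diverges. -/
theorem boost_factor_blowup {lam p0 a b θc : ℝ} {f : ℝ → ℝ} (hlam : 0 < lam) (hab : 0 < a + b)
    (hf : ∀ θ, f θ = (Real.cosh (θ / 2) - Real.sinh (θ / 2) * a) *
      (Real.cosh (θ / 2) + Real.sinh (θ / 2) * b))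
    (hθc : 0 < θc) (hc : Real.coth (θc / 2) = a) :
    (∀ θ, 0 < θ → θ < θc → 0 < f θ) ∧ f θc = 0 ∧
      Filter.Tendsto (fun θ => p0 + lam⁻¹ * Real.log (f θ))
        (nhdsWithin θc (Set.Iio θc)) Filter.atBot := by
  have hsc : 0 < Real.sinh (θc / 2) := Real.sinh_pos_iff.2 (by linarith)
  have key := fun θ : ℝ =>
    Real.sinh_sub_eq_of_coth_eq (y := θ / 2) (half_pos hθc) hc
  have hpos : ∀ θ, 0 < θ → θ < θc → 0 < f θ := by
    intro θ h0 h1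
    have hs : 0 < Real.sinh (θ / 2) := Real.sinh_pos_iff.2 (by linarith)
    have h2 : 0 < Real.cosh (θ / 2) - Real.sinh (θ / 2) * a := by
      have : 0 < Real.sinh (θc / 2 - θ / 2) := Real.sinh_pos_iff.2 (by linarith)
      rw [key] at this
      exact pos_of_mul_pos_right this hsc.le
    rw [hf]
    exact mul_pos h2 (by nlinarith [mul_pos hs hab])
  have hzero : f θc = 0 := by
    have h := key θc
    rw [sub_self, Real.sinh_zero, zero_eq_mul, or_iff_right hsc.ne'] at h
    rw [hf, h, zero_mul]
  refine ⟨hpos, hzero, Filter.tendsto_atBot_add_const_left _ _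
    (Filter.Tendsto.const_mul_atBot (inv_pos.2 hlam) (Real.tendsto_log_nhdsGT_zero.comp
      (tendsto_nhdsWithin_iff.2 ⟨?_, ?_⟩)))⟩
  · have hcont : Continuous f := by
      rw [funext hf]
      have := Real.continuous_cosh
      have := Real.continuous_sinh
      fun_prop
    have := hcont.tendsto θc
    rw [hzero] at this
    exact this.mono_left nhdsWithin_le_nhds
  · filter_upwards [Ioo_mem_nhdsLT hθc] with θ hθ
    exact hpos θ hθ.1 hθ.2

/-- Off-shell momenta are boosted to infinitely negative energy by
a finite boost.  For `λ > 0`, `q = e^{−λp⁰}` and `(p⁰,p¹)` strictly outside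
region A (`λ|p¹| > 1 − q`): if `q − λp¹ > 1` there is a unique `θ_c > 0` with
`coth(θ_c/2) = q − λp¹`; if `q + λp¹ > 1` there is a unique `θ_c < 0` with
`−coth(θ_c/2) = q + λp¹`; and in either case, with
`D(θ) = (cosh(θ/2) + sinh(θ/2)λp¹)² − sinh²(θ/2)q²`, one has `D(θ) > 0`
strictly between `0` and `θ_c`, `D(θ_c) = 0`, and
`p⁰'(θ) = p⁰ + λ⁻¹ log D(θ) → −∞` as `θ → θ_c` from the side of `0`. -/
theorem offshell_infinite_negative_energy (lam p0 p1 q : ℝ)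
    (hlam : 0 < lam) (hq : q = Real.exp (-(lam * p0)))
    (hout : 1 - q < lam * |p1|)
    (D : ℝ → ℝ)
    (hD : ∀ θ, D θ = (Real.cosh (θ / 2) + Real.sinh (θ / 2) * (lam * p1)) ^ 2 -
      (Real.sinh (θ / 2)) ^ 2 * q ^ 2) :
    (1 < q - lam * p1 →
      (∃! θc : ℝ, 0 < θc ∧ Real.coth (θc / 2) = q - lam * p1) ∧
      (∀ θc : ℝ, 0 < θc → Real.coth (θc / 2) = q - lam * p1 →
        (∀ θ, 0 < θ → θ < θc → 0 < D θ) ∧ D θc = 0 ∧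
        Filter.Tendsto (fun θ => p0 + lam⁻¹ * Real.log (D θ))
          (nhdsWithin θc (Set.Iio θc)) Filter.atBot)) ∧
    (1 < q + lam * p1 →
      (∃! θc : ℝ, θc < 0 ∧ -Real.coth (θc / 2) = q + lam * p1) ∧
      (∀ θc : ℝ, θc < 0 → -Real.coth (θc / 2) = q + lam * p1 →
        (∀ θ, θc < θ → θ < 0 → 0 < D θ) ∧ D θc = 0 ∧
        Filter.Tendsto (fun θ => p0 + lam⁻¹ * Real.log (D θ))
          (nhdsWithin θc (Set.Ioi θc)) Filter.atBot)) := by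
  have hq0 : 0 < q := hq ▸ Real.exp_pos _
  refine ⟨fun ha => ⟨Real.existsUnique_pos_coth_half_eq ha, fun θc h0 hc => ?_⟩,
    fun ha => ⟨?_, fun θc h0 hc => ?_⟩⟩
  · exact boost_factor_blowup (a := q - lam * p1) (b := q + lam * p1) hlam (by linarith)
      (fun θ => by rw [hD]; ring) h0 hc
  · obtain ⟨x, ⟨hx, hxa⟩, hu⟩ := Real.existsUnique_pos_coth_half_eq ha
    refine ⟨-x, ⟨by linarith, by rw [neg_div, Real.coth_neg, neg_neg, hxa]⟩, ?_⟩
    rintro θ ⟨hθ, hθa⟩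
    rw [← hu (-θ) ⟨by linarith, by rw [neg_div, Real.coth_neg, hθa]⟩, neg_neg]
  · obtain ⟨hpos, hzero, hlim⟩ := boost_factor_blowup (p0 := p0) (f := fun θ => D (-θ))
      (a := q + lam * p1) (b := q - lam * p1) hlam (by linarith)
      (fun θ => by rw [hD, neg_div, Real.cosh_neg, Real.sinh_neg]; ring)
      (neg_pos.2 h0) (by rw [neg_div, Real.coth_neg, hc])
    refine ⟨fun θ h1 h2 => ?_, by simpa using hzero, ?_⟩
    · simpa using hpos (-θ) (by linarith) (by linarith)
    · simpa [Function.comp_def] using hlim.comp (tendsto_neg_nhdsGT (a := θc))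
end

section
/- Let λ > 0, θ > 0 and p⁰ ∈ ℝ, and write C = cosh(θ/2), S = sinh(θ/2), q = e^{−λp⁰}. Define the critical momentum p¹_c = (q − coth(θ/2))/λ. Then (p⁰, p¹_c) lies outside region A (indeed q − λp¹_c = coth(θ/2) > 1), for p¹ > p¹_c one has D(p¹) = (C + Sλp¹)² − S²q² > 0, and the transformed rapidity θ'(p¹) = 2·arsinh(Sq/√(D(p¹))) tends to +∞ as p¹ tends to p¹_c from above. -/
theorem Real.tendsto_arsinh_atTop : Filter.Tendsto Real.arsinh Filter.atTop Filter.atTop :=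
  Real.sinhOrderIso.symm.tendsto_atTop

theorem Real.one_lt_coth {x : ℝ} (hx : 0 < x) : 1 < Real.coth x := by
  rw [Real.coth, one_lt_div (Real.sinh_pos_iff.2 hx)]
  exact Real.sinh_lt_cosh x

/-- For `λ > 0`, `θ > 0` and `C = cosh(θ/2)`, `S = sinh(θ/2)`,
`q = e^{−λp⁰}`, the critical momentum `p¹_c = (q − coth(θ/2))/λ` lies outside
region A (indeed `q − λp¹_c = coth(θ/2) > 1`), for `p¹ > p¹_c` one has
`D(p¹) = (C + Sλp¹)² − S²q² > 0`, and the transformed rapidity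
`θ'(p¹) = 2 arsinh(Sq/√(D(p¹)))` tends to `+∞` as `p¹ → p¹_c` from above. -/
theorem critical_curve_rapidity_blowup (lam θ p0 : ℝ)
    (hlam : 0 < lam) (hθ : 0 < θ)
    (C S q p1c : ℝ)
    (hC : C = Real.cosh (θ / 2)) (hS : S = Real.sinh (θ / 2))
    (hq : q = Real.exp (-(lam * p0)))
    (hp1c : p1c = (q - Real.coth (θ / 2)) / lam)
    (D : ℝ → ℝ)
    (hD : ∀ p1, D p1 = (C + S * (lam * p1)) ^ 2 - S ^ 2 * q ^ 2) :
    q - lam * p1c = Real.coth (θ / 2) ∧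
    1 < Real.coth (θ / 2) ∧
    1 - q < lam * |p1c| ∧
    (∀ p1, p1c < p1 → 0 < D p1) ∧
    Filter.Tendsto (fun p1 => 2 * Real.arsinh (S * q / Real.sqrt (D p1)))
      (nhdsWithin p1c (Set.Ioi p1c)) Filter.atTop := by
  have hS0 : 0 < S := hS ▸ Real.sinh_pos_iff.2 (half_pos hθ)
  have hq0 : 0 < q := hq ▸ Real.exp_pos _
  have hcoth : 1 < Real.coth (θ / 2) := Real.one_lt_coth (half_pos hθ)
  have hmom : q - lam * p1c = Real.coth (θ / 2) := by
    rw [hp1c]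
    field_simp
    ring
  have hcrit : C + S * (lam * p1c) = S * q := by
    have hSC : S * Real.coth (θ / 2) = C := by
      rw [Real.coth, ← hS, ← hC]
      field_simp
    linear_combination -hSC - S * hmom
  have hpos : ∀ p1, p1c < p1 → 0 < D p1 := by
    intro p1 hp
    have hlt : S * q < C + S * (lam * p1) := by
      rw [← hcrit]
      gcongr
    rw [hD, ← mul_pow, sub_pos]
    exact pow_lt_pow_left₀ hlt (by positivity) two_ne_zero
  refine ⟨hmom, hcoth, ?_, hpos, ?_⟩
  · nlinarith [neg_abs_le p1c]
  · have hDlim : Filter.Tendsto (fun p1 => Real.sqrt (D p1))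
        (nhdsWithin p1c (Set.Ioi p1c)) (nhdsWithin 0 (Set.Ioi 0)) := by
      refine tendsto_nhdsWithin_iff.2 ⟨?_, ?_⟩
      · have hcont : Continuous fun p1 => Real.sqrt (D p1) := by
          simp only [hD]
          fun_prop
        have hzero : Real.sqrt (D p1c) = 0 := by
          rw [hD, hcrit, mul_pow, sub_self, Real.sqrt_zero]
        exact hzero ▸ (hcont.tendsto p1c).mono_left nhdsWithin_le_nhds
      · filter_upwards [self_mem_nhdsWithin] with p1 hp
        exact Real.sqrt_pos.2 (hpos p1 hp)
    have hquot := (Filter.Tendsto.comp tendsto_inv_nhdsGT_zero hDlim).const_mul_atTop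
      (mul_pos hS0 hq0)
    exact (Real.tendsto_arsinh_atTop.comp hquot).const_mul_atTop two_pos
end

section
/- Let λ > 0, θ, p⁰, p¹ ∈ ℝ with C = cosh(θ/2), S = sinh(θ/2), q = e^{−λp⁰}, and assume D = (C + Sλp¹)² − S²q² > 0. Define p⁰' = p⁰ + λ⁻¹ log D and p¹' = ((C + Sλp¹)(S + Cλp¹) − SCq²)/(λD). Then the deformed Minkowski norm is invariant under the boost action: (p¹')² e^{λp⁰'} − (2/λ²)(cosh(λp⁰') − 1) = (p¹)² e^{λp⁰} − (2/λ²)(cosh(λp⁰) − 1). -/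
/-- The polynomial identity behind the invariance: with `N` the numerator of `λp¹'`, `D` the
factor rescaling `e^{λp⁰}` and `C² − S² = 1`, one has `N² − D² − q² = D(x² − 1 − q²)`. -/
theorem boost_polynomial_identity {R : Type*} [CommRing R] {C S : R} (h : C ^ 2 - S ^ 2 = 1)
    (q x : R) :
    ((C + S * x) * (S + C * x) - S * C * q ^ 2) ^ 2
        - ((C + S * x) ^ 2 - S ^ 2 * q ^ 2) ^ 2 - q ^ 2 =
      ((C + S * x) ^ 2 - S ^ 2 * q ^ 2) * (x ^ 2 - 1 - q ^ 2) := by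
  grind

/-- The deformed Minkowski norm
`‖(p⁰,p¹)‖²_λ = (p¹)²e^{λp⁰} − (2/λ²)(cosh(λp⁰) − 1)` is invariant under the
nonlinear boost action `(p⁰,p¹) ↦ (p⁰',p¹')` where, with `C = cosh(θ/2)`,
`S = sinh(θ/2)`, `q = e^{−λp⁰}` and `D = (C+Sλp¹)² − S²q² > 0`,
`p⁰' = p⁰ + λ⁻¹ log D` and `p¹' = ((C+Sλp¹)(S+Cλp¹) − SCq²)/(λD)`. -/
theorem deformed_norm_boost_invariant (lam θ p0 p1 : ℝ) (hlam : 0 < lam)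
    (C S q D p0' p1' : ℝ)
    (hC : C = Real.cosh (θ / 2)) (hS : S = Real.sinh (θ / 2))
    (hq : q = Real.exp (-(lam * p0)))
    (hD : D = (C + S * (lam * p1)) ^ 2 - S ^ 2 * q ^ 2) (hDpos : 0 < D)
    (hp0' : p0' = p0 + lam⁻¹ * Real.log D)
    (hp1' : p1' = ((C + S * (lam * p1)) * (S + C * (lam * p1)) - S * C * q ^ 2) / (lam * D)) :
    p1' ^ 2 * Real.exp (lam * p0') - (2 / lam ^ 2) * (Real.cosh (lam * p0') - 1) =
      p1 ^ 2 * Real.exp (lam * p0) - (2 / lam ^ 2) * (Real.cosh (lam * p0) - 1) := by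
  have hcs : C ^ 2 - S ^ 2 = 1 := by
    rw [hC, hS]
    exact Real.cosh_sq_sub_sinh_sq _
  have hq0 : 0 < q := hq ▸ Real.exp_pos _
  have hE : Real.exp (lam * p0) = q⁻¹ := by rw [hq, Real.exp_neg, inv_inv]
  have hE' : Real.exp (lam * p0') = D / q := by
    rw [hp0', mul_add, mul_inv_cancel_left₀ hlam.ne', Real.exp_add, Real.exp_log hDpos, hE]
    ring
  have key := boost_polynomial_identity hcs q (lam * p1)
  rw [← hD] at key
  rw [Real.cosh_eq, Real.cosh_eq, Real.exp_neg, Real.exp_neg, hE, hE', hp1']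
  generalize (C + S * (lam * p1)) * (S + C * (lam * p1)) - S * C * q ^ 2 = N at key ⊢
  have hD0 := hDpos.ne'
  have hl0 := hlam.ne'
  have hq1 := hq0.ne'
  field_simp
  linear_combination key
end

section
/- Let λ > 0 and define f(p⁰,p¹) = (p¹)² e^{λp⁰} − (2/λ²)(cosh(λp⁰) − 1) on ℝ². Then the boost vector field of the bicrossproduct model annihilates f: for all (p⁰,p¹), p¹·∂f/∂p⁰ + (1/2)((1 − e^{−2λp⁰})/λ − λ(p¹)²)·∂f/∂p¹ = 0. -/
/-- The boost vector field
`α_N = p¹ ∂/∂p⁰ + (1/2)((1 − e^{−2λp⁰})/λ − λ(p¹)²) ∂/∂p¹` annihilates the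
deformed Minkowski norm `f(p⁰,p¹) = (p¹)²e^{λp⁰} − (2/λ²)(cosh(λp⁰) − 1)`. -/
theorem boost_vector_field_annihilates_norm (lam : ℝ) (hlam : 0 < lam)
    (f : ℝ → ℝ → ℝ)
    (hf : ∀ a b : ℝ, f a b =
      b ^ 2 * Real.exp (lam * a) - (2 / lam ^ 2) * (Real.cosh (lam * a) - 1)) :
    ∀ p0 p1 : ℝ,
      p1 * deriv (fun a => f a p1) p0 +
        (1 / 2) * ((1 - Real.exp (-(2 * lam * p0))) / lam - lam * p1 ^ 2) *
          deriv (fun b => f p0 b) p1 = 0 := by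
  intro p0 p1
  have hl : lam ≠ 0 := hlam.ne'
  have h_lin : HasDerivAt (fun a : ℝ => lam * a) lam p0 := by
    simpa using (hasDerivAt_id p0).const_mul lam
  have h_energy : HasDerivAt (fun a => f a p1)
      (p1 ^ 2 * (Real.exp (lam * p0) * lam)
        - (2 / lam ^ 2) * (Real.sinh (lam * p0) * lam)) p0 := by
    simp only [hf]
    exact (h_lin.exp.const_mul _).sub ((h_lin.cosh.sub_const 1).const_mul _)
  have h_momentum : HasDerivAt (fun b => f p0 b)
      (2 * p1 * Real.exp (lam * p0)) p1 := by
    simp only [hf]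
    simpa using ((hasDerivAt_pow 2 p1).mul_const (Real.exp (lam * p0))).sub_const
      ((2 / lam ^ 2) * (Real.cosh (lam * p0) - 1))
  have h_exp : Real.exp (-(2 * lam * p0)) = Real.exp (-(lam * p0)) ^ 2 := by
    rw [← Real.exp_nat_mul]
    congr 1
    push_cast
    ring
  rw [h_energy.deriv, h_momentum.deriv, h_exp, Real.sinh_eq, Real.exp_neg]
  have h_pos : Real.exp (lam * p0) ≠ 0 := Real.exp_ne_zero _
  field_simp
  ring
end

section
/- Let λ > 0 and p⁰, p¹ ∈ ℝ. Define, for θ in a neighbourhood of 0 (where D(θ) = (cosh(θ/2) + sinh(θ/2)λp¹)² − sinh²(θ/2)e^{−2λp⁰} > 0), the boosted momenta p⁰'(θ) = p⁰ + λ⁻¹ log D(θ) and p¹'(θ) = ((C + Sλp¹)(S + Cλp¹) − SC e^{−2λp⁰})/(λD(θ)) with C = cosh(θ/2), S = sinh(θ/2). Then the derivatives at θ = 0 are (d/dθ)p⁰'(0) = p¹ and (d/dθ)p¹'(0) = (1/2)((1 − e^{−2λp⁰})/λ − λ(p¹)²). -/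
/-- The derivatives at `θ = 0` of the boosted momenta
`p⁰'(θ) = p⁰ + λ⁻¹ log D(θ)` and
`p¹'(θ) = ((C+Sλp¹)(S+Cλp¹) − SC e^{−2λp⁰})/(λD(θ))`, where
`C = cosh(θ/2)`, `S = sinh(θ/2)` and
`D(θ) = (C + Sλp¹)² − S²e^{−2λp⁰}`, are the components of the boost vector
field: `(d/dθ)p⁰'(0) = p¹` and
`(d/dθ)p¹'(0) = (1/2)((1 − e^{−2λp⁰})/λ − λ(p¹)²)`. -/
theorem boost_vector_field_from_finite_boost (lam p0 p1 : ℝ) (hlam : 0 < lam)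
    (D : ℝ → ℝ)
    (hD : ∀ θ, D θ = (Real.cosh (θ / 2) + Real.sinh (θ / 2) * (lam * p1)) ^ 2 -
      (Real.sinh (θ / 2)) ^ 2 * Real.exp (-(2 * lam * p0))) :
    deriv (fun θ => p0 + lam⁻¹ * Real.log (D θ)) 0 = p1 ∧
    deriv (fun θ =>
      ((Real.cosh (θ / 2) + Real.sinh (θ / 2) * (lam * p1)) *
        (Real.sinh (θ / 2) + Real.cosh (θ / 2) * (lam * p1)) -
        Real.sinh (θ / 2) * Real.cosh (θ / 2) * Real.exp (-(2 * lam * p0))) /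
      (lam * D θ)) 0 =
      (1 / 2) * ((1 - Real.exp (-(2 * lam * p0))) / lam - lam * p1 ^ 2) := by
  have hhalf : HasDerivAt (fun θ : ℝ => θ / 2) (1 / 2) 0 := (hasDerivAt_id 0).div_const 2
  have hC : HasDerivAt (fun θ : ℝ => Real.cosh (θ / 2)) 0 0 := by
    simpa using hhalf.cosh
  have hS : HasDerivAt (fun θ : ℝ => Real.sinh (θ / 2)) (1 / 2) 0 := by
    simpa using hhalf.sinh
  have hD0 : D 0 = 1 := by simp [hD]
  have hD' : HasDerivAt D (lam * p1) 0 := by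
    rw [funext hD]
    refine (((hC.add (hS.mul_const (lam * p1))).pow 2).sub
      ((hS.pow 2).mul_const (Real.exp (-(2 * lam * p0))))).congr_deriv ?_
    simp
  constructor
  · refine (((hD'.log (by simp [hD0])).const_mul lam⁻¹).const_add p0).deriv.trans ?_
    rw [hD0]
    field_simp
  · have hN := ((hC.add (hS.mul_const (lam * p1))).mul (hS.add (hC.mul_const (lam * p1)))).sub
      ((hS.mul hC).mul_const (Real.exp (-(2 * lam * p0))))
    refine (hN.div (hD'.const_mul lam) (by simp [hD0, hlam.ne'])).deriv.trans ?_
    simp [hD0]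
    field_simp
    ring
end

section
/- Let λ > 0 and θ ∈ ℝ, and write C = cosh(θ/2), S = sinh(θ/2). Define, for (p⁰,p¹) in a neighbourhood of (0,0), θ'(p⁰,p¹) = 2·arsinh(S e^{−λp⁰}/√D) with D = (C + Sλp¹)² − S²e^{−2λp⁰}. Then θ'(0,0) = θ, and the partial derivatives at (p⁰,p¹) = (0,0) are ∂θ'/∂p⁰ = −λ sinh θ and ∂θ'/∂p¹ = −λ(cosh θ − 1). -/
open Real in
/-- Derivative of `2 arsinh (N / √D)` at a point where `N = sinh η` and `D = 1`. -/
theorem HasDerivAt.two_mul_arsinh_div_sqrt {N D : ℝ → ℝ} {N' D' x η : ℝ}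
    (hN : HasDerivAt N N' x) (hD : HasDerivAt D D' x) (hNx : N x = Real.sinh η) (hDx : D x = 1) :
    HasDerivAt (fun y => 2 * Real.arsinh (N y / √(D y)))
      (2 * (N' - Real.sinh η * D' / 2) / Real.cosh η) x := by
  have hsqrt : √(1 + Real.sinh η ^ 2) = Real.cosh η := by
    rw [add_comm, ← Real.cosh_sq, sqrt_sq (Real.cosh_pos η).le]
  have h := ((hN.div (hD.sqrt (by simp [hDx])) (by simp [hDx])).arsinh).const_mul 2
  refine h.congr_deriv ?_
  simp only [Pi.div_apply, hNx, hDx, sqrt_one, div_one, smul_eq_mul, hsqrt]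
  have := (Real.cosh_pos η).ne'
  field_simp

/-- The back-reaction
`θ'(p⁰,p¹) = 2 arsinh(sinh(θ/2)e^{−λp⁰}/√D)` with
`D = (cosh(θ/2) + sinh(θ/2)λp¹)² − sinh²(θ/2)e^{−2λp⁰}` satisfies
`θ'(0,0) = θ`, `∂θ'/∂p⁰(0,0) = −λ sinh θ` and
`∂θ'/∂p¹(0,0) = −λ(cosh θ − 1)`. -/
theorem back_reaction_vector_fields (lam θ : ℝ) (hlam : 0 < lam)
    (θ' : ℝ → ℝ → ℝ)
    (hθ' : ∀ p0 p1 : ℝ, θ' p0 p1 =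
      2 * Real.arsinh (Real.sinh (θ / 2) * Real.exp (-(lam * p0)) /
        Real.sqrt ((Real.cosh (θ / 2) + Real.sinh (θ / 2) * (lam * p1)) ^ 2 -
          (Real.sinh (θ / 2)) ^ 2 * Real.exp (-(2 * lam * p0))))) :
    θ' 0 0 = θ ∧
    deriv (fun p0 => θ' p0 0) 0 = -(lam * Real.sinh θ) ∧
    deriv (fun p1 => θ' 0 p1) 0 = -(lam * (Real.cosh θ - 1)) := by
  have hC := (Real.cosh_pos (θ / 2)).ne'
  have hsq := Real.cosh_sq (θ / 2)
  have hexp (c : ℝ) : HasDerivAt (fun p : ℝ => Real.exp (-(c * p))) (-c) 0 := by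
    simpa using (((hasDerivAt_id (0 : ℝ)).const_mul c).neg).exp
  have hsinh : Real.sinh θ = 2 * Real.sinh (θ / 2) * Real.cosh (θ / 2) := by
    rw [← Real.sinh_two_mul]; ring_nf
  have hcosh : Real.cosh θ = Real.cosh (θ / 2) ^ 2 + Real.sinh (θ / 2) ^ 2 := by
    rw [← Real.cosh_two_mul]; ring_nf
  refine ⟨?_, ?_, ?_⟩
  · rw [hθ']
    simp [hsq, Real.arsinh_sinh, mul_div_cancel₀]
  · simp only [hθ']
    have hN := (hexp lam).const_mul (Real.sinh (θ / 2))
    have hD := ((hexp (2 * lam)).const_mul (Real.sinh (θ / 2) ^ 2)).const_sub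
      ((Real.cosh (θ / 2) + Real.sinh (θ / 2) * (lam * 0)) ^ 2)
    rw [(hN.two_mul_arsinh_div_sqrt hD (η := θ / 2) (by simp) (by simp [hsq])).deriv, hsinh]
    field_simp
    rw [hsq]
    ring
  · simp only [hθ']
    have hN := hasDerivAt_const (0 : ℝ) (Real.sinh (θ / 2) * Real.exp (-(lam * 0)))
    have hD := (((((hasDerivAt_id (0 : ℝ)).const_mul lam).const_mul (Real.sinh (θ / 2))).const_add
      (Real.cosh (θ / 2))).pow 2).sub_const
      (Real.sinh (θ / 2) ^ 2 * Real.exp (-(2 * lam * 0)))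
    refine (hN.two_mul_arsinh_div_sqrt hD (η := θ / 2) (by simp) (by simp [hsq])).deriv.trans ?_
    rw [hcosh, hsq]
    simp
    field_simp
    ring
end

section
/- Let λ > 0 and p⁰, p¹ ∈ ℝ with p⁰ ≥ 0. If ‖(p⁰,p¹)‖²_λ = (p¹)² e^{λp⁰} − (2/λ²)(cosh(λp⁰) − 1) ≤ 0 (i.e., (p⁰,p¹) lies on or inside an upper mass shell), then the spatial momentum obeys the Planckian bound |p¹| < 1/λ. -/
theorem two_mul_cosh_sub_one_lt_exp {x : ℝ} (hx : 0 ≤ x) :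
    2 * (Real.cosh x - 1) < Real.exp x := by
  have hneg : Real.exp (-x) ≤ 1 := Real.exp_le_one_iff.mpr (neg_nonpos.mpr hx)
  rw [Real.cosh_eq]
  linarith

/-- Planckian bound.  For `λ > 0`, if `p⁰ ≥ 0` and
`‖(p⁰,p¹)‖²_λ = (p¹)²e^{λp⁰} − (2/λ²)(cosh(λp⁰) − 1) ≤ 0` (on or inside an
upper mass shell), then `|p¹| < 1/λ`. -/
theorem planckian_bound (lam p0 p1 : ℝ) (hlam : 0 < lam) (hp0 : 0 ≤ p0)
    (hshell : p1 ^ 2 * Real.exp (lam * p0) -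
      (2 / lam ^ 2) * (Real.cosh (lam * p0) - 1) ≤ 0) :
    |p1| < 1 / lam := by
  have hexp : p1 ^ 2 * Real.exp (lam * p0) < (1 / lam) ^ 2 * Real.exp (lam * p0) :=
    calc p1 ^ 2 * Real.exp (lam * p0)
        ≤ 2 / lam ^ 2 * (Real.cosh (lam * p0) - 1) := sub_nonpos.mp hshell
      _ = (1 / lam) ^ 2 * (2 * (Real.cosh (lam * p0) - 1)) := by ring
      _ < (1 / lam) ^ 2 * Real.exp (lam * p0) := by
        gcongr
        exact two_mul_cosh_sub_one_lt_exp (mul_nonneg hlam.le hp0)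
  exact abs_lt_of_sq_lt_sq (lt_of_mul_lt_mul_right hexp (Real.exp_pos _).le)
    (one_div_pos.mpr hlam).le
end

section
/- Let λ > 0 and define, for 0 ≤ p¹ < 1/λ, the massless dispersion relation p⁰(p¹) = −λ⁻¹ log(1 − λp¹). Then (i) ‖(p⁰(p¹), p¹)‖²_λ = (p¹)² e^{λp⁰(p¹)} − (2/λ²)(cosh(λp⁰(p¹)) − 1) = 0 for all such p¹, and (ii) the group velocity is energy dependent: (d/dp¹)p⁰(p¹) = e^{λ p⁰(p¹)}, which is strictly greater than 1 for 0 < p¹ < 1/λ (a variable speed of light). -/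
/-- Variable speed of light.  For `λ > 0` and
`0 ≤ p¹ < 1/λ`, the massless dispersion relation
`p⁰(p¹) = −λ⁻¹ log(1 − λp¹)` satisfies
(i) `‖(p⁰(p¹),p¹)‖²_λ = (p¹)²e^{λp⁰(p¹)} − (2/λ²)(cosh(λp⁰(p¹)) − 1) = 0`, and
(ii) the group velocity is `(d/dp¹)p⁰(p¹) = e^{λp⁰(p¹)}`, which is strictly
greater than `1` for `0 < p¹ < 1/λ`. -/
theorem variable_speed_of_light (lam : ℝ) (hlam : 0 < lam)
    (P : ℝ → ℝ) (hP : ∀ p1 : ℝ, P p1 = -lam⁻¹ * Real.log (1 - lam * p1)) :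
    ∀ p1 : ℝ, 0 ≤ p1 → p1 < 1 / lam →
      (p1 ^ 2 * Real.exp (lam * P p1) -
        (2 / lam ^ 2) * (Real.cosh (lam * P p1) - 1) = 0) ∧
      deriv P p1 = Real.exp (lam * P p1) ∧
      (0 < p1 → 1 < Real.exp (lam * P p1)) := by
  intro p1 h0 h1
  have hu : 0 < 1 - lam * p1 := by
    rw [lt_div_iff₀ hlam] at h1
    linarith
  have hlP : lam * P p1 = -Real.log (1 - lam * p1) := by
    rw [hP]
    field_simp
  have hexp : Real.exp (lam * P p1) = (1 - lam * p1)⁻¹ := by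
    rw [hlP, Real.exp_neg, Real.exp_log hu]
  refine ⟨?_, ?_, fun hp => ?_⟩
  · rw [Real.cosh_eq, Real.exp_neg, hexp, inv_inv]
    have hc : (1 - lam * p1)⁻¹ * (1 - lam * p1) = 1 := inv_mul_cancel₀ hu.ne'
    generalize (1 - lam * p1)⁻¹ = c at hc ⊢
    field_simp
    linear_combination (-(1 + lam * p1)) * hc
  · have hd : HasDerivAt (fun x : ℝ => 1 - lam * x) (-lam) p1 := by
      simpa using ((hasDerivAt_id p1).const_mul lam).const_sub 1
    rw [hexp, funext hP, ((hd.log hu.ne').const_mul (-lam⁻¹)).deriv]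
    field_simp
  · rw [hexp]
    exact (one_lt_inv₀ hu).mpr (by linarith [mul_pos hlam hp])
end
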